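/- arXiv:1202.6188 — 2 statements merged into one kernel-verified Lean document; each statement's English description precedes it below -/
import Mathlib

section
/- For every nondecreasing sequence of stopping times (τ_i)_{i∈ℕ} with values in [0,T] ∪ {T+1}, one has Q(lim_{i→∞} τ_i ≥ S) = 1 if and only if Q̂(lim_{i→∞} τ_i ≥ R) = 1. -/
open MeasureTheory Filter Set Topology
open scoped ENNReal NNReal

noncomputable section

namespace Paper

/-- `τ` is a stopping time with respect to the raw filtration `F`,
taking values in `[0,T] ∪ {T+1}`. -/
def IsStopT {Ω : Type*} (F : ℝ → MeasurableSpace Ω) (T : ℝ) (τ : Ω → ℝ) : Prop :=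
  (∀ t : ℝ, MeasurableSet[F t] {ω | τ ω ≤ t}) ∧ ∀ ω, τ ω ∈ Icc (0:ℝ) T ∪ {T + 1}

/-- `A ∈ F_τ`, the σ-algebra associated with the stopping time `τ`. -/
def MemFtau {Ω : Type*} (F : ℝ → MeasurableSpace Ω) (τ : Ω → ℝ) (A : Set Ω) : Prop :=
  ∀ t : ℝ, MeasurableSet[F t] (A ∩ {ω | τ ω ≤ t})

/-- the σ-algebra `F_τ` of a stopping time `τ` (for a stopping time the generating
family below is already a σ-algebra, so this is exactly the usual `F_τ`). -/
def sigmaAt {Ω : Type*} (F : ℝ → MeasurableSpace Ω) (τ : Ω → ℝ) : MeasurableSpace Ω :=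
  MeasurableSpace.generateFrom {A | MemFtau F τ A}

/-- the stopped process `N^τ`, i.e. `N^τ_t := N_{t ∧ τ ∧ T}`. -/
def stopped {Ω : Type*} (T : ℝ) (N : ℝ → Ω → ℝ≥0∞) (τ : Ω → ℝ) : ℝ → Ω → ℝ≥0∞ :=
  fun t ω => N (min t (min (τ ω) T)) ω

/-- the value of a process at a stopping time, `N_τ := N_{τ ∧ T}`. -/
def valueAt {Ω : Type*} (T : ℝ) (N : ℝ → Ω → ℝ≥0∞) (τ : Ω → ℝ) : Ω → ℝ≥0∞ :=
  fun ω => N (min (τ ω) T) ω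

/-- `N` is a `P`-martingale on the time horizon `[0,T]`: it is adapted, `P`-integrable, and
satisfies `E^P[N_t ∣ F_s] = N_s` for all `0 ≤ s ≤ t ≤ T`.  For nonnegative
(`ℝ≥0∞`-valued) integrable adapted processes the conditional-expectation identity is
equivalent to the defining set-integral identity used here. -/
def IsMart {Ω : Type*} (F : ℝ → MeasurableSpace Ω) (T : ℝ) (P : @Measure Ω (F T))
    (N : ℝ → Ω → ℝ≥0∞) : Prop :=
  (∀ t ∈ Icc (0:ℝ) T, Measurable[F t] (N t)) ∧
  (∀ t ∈ Icc (0:ℝ) T, ∫⁻ ω, N t ω ∂P ≠ ⊤) ∧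
  ∀ s t : ℝ, 0 ≤ s → s ≤ t → t ≤ T → ∀ A : Set Ω, MeasurableSet[F s] A →
    ∫⁻ ω in A, N t ω ∂P = ∫⁻ ω in A, N s ω ∂P

/-- `N` is a `P`-local martingale on `[0,T]`. -/
def IsLocMart {Ω : Type*} (F : ℝ → MeasurableSpace Ω) (T : ℝ) (P : @Measure Ω (F T))
    (N : ℝ → Ω → ℝ≥0∞) : Prop :=
  ∃ τ : ℕ → Ω → ℝ, (∀ n, IsStopT F T (τ n)) ∧ (∀ n ω, τ n ω ≤ τ (n + 1) ω) ∧
    P {ω | ∀ᶠ n in atTop, τ n ω = T + 1} = 1 ∧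
    ∀ n, IsMart F T P (stopped T N (τ n))

/-- `N` is a `P`-local martingale on the stochastic interval `[0,τ)`. -/
def IsLocMartBefore {Ω : Type*} (F : ℝ → MeasurableSpace Ω) (T : ℝ) (P : @Measure Ω (F T))
    (N : ℝ → Ω → ℝ≥0∞) (τ : Ω → ℝ) : Prop :=
  ∀ σ : Ω → ℝ, IsStopT F T σ → (∀ᵐ ω ∂P, σ ω < τ ω) → IsLocMart F T P (stopped T N σ)

/-- `N` is a `P`-martingale on the stochastic interval `[0,τ)`. -/
def IsMartBefore {Ω : Type*} (F : ℝ → MeasurableSpace Ω) (T : ℝ) (P : @Measure Ω (F T))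
    (N : ℝ → Ω → ℝ≥0∞) (τ : Ω → ℝ) : Prop :=
  ∀ σ : Ω → ℝ, IsStopT F T σ → (∀ᵐ ω ∂P, σ ω < τ ω) → IsMart F T P (stopped T N σ)

/-- the first time in `[0,T]` at which `X` is `≥ c`; equal to `T+1` if this never
happens (`inf ∅ := T+1`). -/
def hitAbove {Ω : Type*} (T : ℝ) (X : ℝ → Ω → ℝ≥0∞) (c : ℝ≥0∞) (ω : Ω) : ℝ :=
  sInf ({t ∈ Icc (0:ℝ) T | c ≤ X t ω} ∪ {T + 1})

/-- the first time in `[0,T]` at which `X` is `≤ c`; equal to `T+1` if this never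
happens (`inf ∅ := T+1`). -/
def hitBelow {Ω : Type*} (T : ℝ) (X : ℝ → Ω → ℝ≥0∞) (c : ℝ≥0∞) (ω : Ω) : ℝ :=
  sInf ({t ∈ Icc (0:ℝ) T | X t ω ≤ c} ∪ {T + 1})

/-- `R = lim_i R_i` where `R_i = inf {t ∈ [0,T] : X_t ≥ i}` (explosion time of `X`);
the nondecreasing limit is the supremum. -/
def Rt {Ω : Type*} (T : ℝ) (X : ℝ → Ω → ℝ≥0∞) (ω : Ω) : ℝ :=
  ⨆ i : ℕ, hitAbove T X (i : ℝ≥0∞) ω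

/-- `S = lim_i S_i` where `S_i = inf {t ∈ [0,T] : X_t ≤ 1/i}` (hitting time of `0`);
the nondecreasing limit is the supremum. -/
def St {Ω : Type*} (T : ℝ) (X : ℝ → Ω → ℝ≥0∞) (ω : Ω) : ℝ :=
  ⨆ i : ℕ, hitBelow T X ((i : ℝ≥0∞))⁻¹ ω

/-- The standing assumptions: `0 < T`; `(F_t)` is a (monotone) filtration that is
right-continuous on `[0,T)`; `X` is adapted with continuous `[0,∞]`-valued paths absorbed
at `0` and `∞`; `x₀ ∈ (0,∞)`; `Q` is a probability measure on `F_T` with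
`Q(R = T+1) = 1`, `Q(X_0 = x₀) = 1` and `X` a `Q`-local martingale. -/
structure Setup {Ω : Type*} (F : ℝ → MeasurableSpace Ω) (T : ℝ) (X : ℝ → Ω → ℝ≥0∞)
    (x₀ : ℝ≥0∞) (Q : @Measure Ω (F T)) : Prop where
  T_pos : 0 < T
  mono : ∀ s t : ℝ, s ≤ t → F s ≤ F t
  rightCont : ∀ t ∈ Ico (0:ℝ) T, F t = ⨅ s ∈ Ioc t T, F s
  prob : IsProbabilityMeasure Q
  adapted : ∀ t ∈ Icc (0:ℝ) T, Measurable[F t] (X t)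
  contPaths : ∀ ω, ContinuousOn (fun t => X t ω) (Icc 0 T)
  absorbing : ∀ ω, ∀ t ∈ Icc (0:ℝ) T, (X t ω = 0 ∨ X t ω = ⊤) →
    ∀ s ∈ Icc t T, X s ω = X t ω
  x₀_pos : 0 < x₀
  x₀_lt_top : x₀ < ⊤
  noExplosion : Q {ω | Rt T X ω = T + 1} = 1
  init : Q {ω | X 0 ω = x₀} = 1
  locMart : IsLocMart F T Q X

/-- The numéraire relation between `Q` and `Q̂`: for every stopping time `τ` with values
in `[0,T] ∪ {T+1}` and every `A ∈ F_τ`,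
`Q̂(A ∩ {X_τ < ∞}) = (1/x₀)·E^Q[1_A · X_τ]` (with `X_τ := X_{τ ∧ T}`). -/
def NumeraireRel {Ω : Type*} (F : ℝ → MeasurableSpace Ω) (T : ℝ) (X : ℝ → Ω → ℝ≥0∞)
    (x₀ : ℝ≥0∞) (Q Qh : @Measure Ω (F T)) : Prop :=
  ∀ τ : Ω → ℝ, IsStopT F T τ → ∀ A : Set Ω, MemFtau F τ A →
    Qh (A ∩ {ω | valueAt T X τ ω < ⊤}) = (∫⁻ ω in A, valueAt T X τ ω ∂Q) / x₀

section Paths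

variable {Ω : Type*} {T : ℝ} {X : ℝ → Ω → ℝ≥0∞} {ω : Ω}

/-- The first hitting time of a closed set by a continuous path is attained. -/
lemma sInf_hitting_mem (hcont : ContinuousOn (fun t => X t ω) (Icc 0 T)) {K : Set ℝ≥0∞}
    (hK : IsClosed K) :
    sInf ({t ∈ Icc (0:ℝ) T | X t ω ∈ K} ∪ {T + 1}) ∈
      {t ∈ Icc (0:ℝ) T | X t ω ∈ K} ∪ {T + 1} := by
  refine IsClosed.csInf_mem ?_ ⟨T + 1, Or.inr rfl⟩ ?_
  · exact (hcont.preimage_isClosed_of_isClosed isClosed_Icc hK).union isClosed_singleton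
  · refine ⟨min 0 (T + 1), ?_⟩
    rintro t (ht | rfl)
    · exact (min_le_left _ _).trans ht.1.1
    · exact min_le_right _ _

lemma bddBelow_hitting (p : ℝ≥0∞ → Prop) :
    BddBelow ({t ∈ Icc (0:ℝ) T | p (X t ω)} ∪ {T + 1}) := by
  refine ⟨min 0 (T + 1), ?_⟩
  rintro t (ht | rfl)
  · exact (min_le_left _ _).trans ht.1.1
  · exact min_le_right _ _

lemma hitAbove_le_of_le {c : ℝ≥0∞} {t : ℝ} (ht : t ∈ Icc 0 T) (h : c ≤ X t ω) :
    hitAbove T X c ω ≤ t :=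
  csInf_le (bddBelow_hitting (c ≤ ·)) (Or.inl ⟨ht, h⟩)

lemma hitBelow_le_of_le {c : ℝ≥0∞} {t : ℝ} (ht : t ∈ Icc 0 T) (h : X t ω ≤ c) :
    hitBelow T X c ω ≤ t :=
  csInf_le (bddBelow_hitting (· ≤ c)) (Or.inl ⟨ht, h⟩)

lemma hitAbove_le_horizon (c : ℝ≥0∞) : hitAbove T X c ω ≤ T + 1 :=
  csInf_le (bddBelow_hitting (c ≤ ·)) (Or.inr rfl)

lemma hitBelow_le_horizon (c : ℝ≥0∞) : hitBelow T X c ω ≤ T + 1 :=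
  csInf_le (bddBelow_hitting (· ≤ c)) (Or.inr rfl)

lemma exists_le_of_hitAbove_le (hcont : ContinuousOn (fun t => X t ω) (Icc 0 T)) {c : ℝ≥0∞}
    {u : ℝ} (hu : u ≤ T) (h : hitAbove T X c ω ≤ u) : ∃ t ∈ Icc 0 u, c ≤ X t ω := by
  rcases sInf_hitting_mem hcont (isClosed_Ici (a := c)) with hm | hm
  · exact ⟨hitAbove T X c ω, ⟨hm.1.1, h⟩, hm.2⟩
  · have h1 : hitAbove T X c ω = T + 1 := hm
    linarith

lemma exists_le_of_hitBelow_le (hcont : ContinuousOn (fun t => X t ω) (Icc 0 T)) {c : ℝ≥0∞}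
    {u : ℝ} (hu : u ≤ T) (h : hitBelow T X c ω ≤ u) : ∃ t ∈ Icc 0 u, X t ω ≤ c := by
  rcases sInf_hitting_mem hcont (isClosed_Iic (a := c)) with hm | hm
  · exact ⟨hitBelow T X c ω, ⟨hm.1.1, h⟩, hm.2⟩
  · have h1 : hitBelow T X c ω = T + 1 := hm
    linarith

/-- The explosion time has passed at `u ≤ T` iff the path sits at `∞`. -/
lemma Rt_le_iff (hcont : ContinuousOn (fun t => X t ω) (Icc 0 T))
    (habs : ∀ t ∈ Icc (0:ℝ) T, (X t ω = 0 ∨ X t ω = ⊤) → ∀ s ∈ Icc t T, X s ω = X t ω)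
    {u : ℝ} (hu : u ∈ Icc 0 T) : Rt T X ω ≤ u ↔ X u ω = ⊤ := by
  constructor
  · intro h
    obtain ⟨s, hs, hmax⟩ := isCompact_Icc.exists_isMaxOn (nonempty_Icc.2 hu.1)
      (hcont.mono (Icc_subset_Icc_right hu.2))
    have hs_top : X s ω = ⊤ := by
      refine ENNReal.eq_top_of_forall_nnreal_le fun r => ?_
      obtain ⟨i, hi⟩ := exists_nat_ge r
      have hbdd : BddAbove (range fun i : ℕ => hitAbove T X (i : ℝ≥0∞) ω) :=
        ⟨T + 1, by rintro _ ⟨i, rfl⟩; exact hitAbove_le_horizon _⟩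
      obtain ⟨t, ht, hit⟩ := exists_le_of_hitAbove_le hcont hu.2 ((le_ciSup hbdd i).trans h)
      have hri : (r : ℝ≥0∞) ≤ i := by exact_mod_cast hi
      exact hri.trans (hit.trans (hmax ht))
    rw [habs s ⟨hs.1, hs.2.trans hu.2⟩ (Or.inr hs_top) u ⟨hs.2, hu.2⟩, hs_top]
  · intro h
    exact ciSup_le fun i => hitAbove_le_of_le hu (h ▸ le_top)

/-- The hitting time of zero has passed at `u ≤ T` iff the path sits at `0`. -/
lemma St_le_iff (hcont : ContinuousOn (fun t => X t ω) (Icc 0 T))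
    (habs : ∀ t ∈ Icc (0:ℝ) T, (X t ω = 0 ∨ X t ω = ⊤) → ∀ s ∈ Icc t T, X s ω = X t ω)
    {u : ℝ} (hu : u ∈ Icc 0 T) : St T X ω ≤ u ↔ X u ω = 0 := by
  constructor
  · intro h
    obtain ⟨s, hs, hmin⟩ := isCompact_Icc.exists_isMinOn (nonempty_Icc.2 hu.1)
      (hcont.mono (Icc_subset_Icc_right hu.2))
    have hs_zero : X s ω = 0 := by
      by_contra hne
      obtain ⟨i, hi⟩ := ENNReal.exists_inv_nat_lt hne
      have hbdd : BddAbove (range fun i : ℕ => hitBelow T X ((i : ℝ≥0∞))⁻¹ ω) :=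
        ⟨T + 1, by rintro _ ⟨i, rfl⟩; exact hitBelow_le_horizon _⟩
      obtain ⟨t, ht, hit⟩ := exists_le_of_hitBelow_le hcont hu.2 ((le_ciSup hbdd i).trans h)
      exact absurd ((hmin ht).trans hit) hi.not_ge
    rw [habs s ⟨hs.1, hs.2.trans hu.2⟩ (Or.inl hs_zero) u ⟨hs.2, hu.2⟩, hs_zero]
  · intro h
    exact ciSup_le fun i => hitBelow_le_of_le hu (h ▸ zero_le)

end Paths

/-- The supremum of a sequence of stopping times is a stopping time. -/
lemma IsStopT.iSup {Ω : Type*} {F : ℝ → MeasurableSpace Ω} {T : ℝ} {τ : ℕ → Ω → ℝ}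
    (hT : 0 ≤ T) (hτ : ∀ i, IsStopT F T (τ i)) : IsStopT F T fun ω => ⨆ i, τ i ω := by
  have hle : ∀ i ω, τ i ω ≤ T + 1 := fun i ω => by
    rcases (hτ i).2 ω with h | h
    · linarith [h.2]
    · exact le_of_eq h
  have hnonneg : ∀ i ω, 0 ≤ τ i ω := fun i ω => by
    rcases (hτ i).2 ω with h | h
    · exact h.1
    · rw [mem_singleton_iff.1 h]
      linarith
  have hbdd : ∀ ω, BddAbove (range fun i => τ i ω) := fun ω =>
    ⟨T + 1, by rintro _ ⟨i, rfl⟩; exact hle i ω⟩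
  refine ⟨fun t => ?_, fun ω => ?_⟩
  · have hset : {ω | ⨆ i, τ i ω ≤ t} = ⋂ i, {ω | τ i ω ≤ t} := by
      ext ω
      simp [ciSup_le_iff (hbdd ω)]
    rw [hset]
    exact @MeasurableSet.iInter _ _ (F t) _ _ fun i => (hτ i).1 t
  · by_cases h : ∃ i, τ i ω = T + 1
    · obtain ⟨i, hi⟩ := h
      exact Or.inr (le_antisymm (ciSup_le fun j => hle j ω) (hi ▸ le_ciSup (hbdd ω) i))
    · push Not at h
      refine Or.inl ⟨(hnonneg 0 ω).trans (le_ciSup (hbdd ω) 0), ciSup_le fun i => ?_⟩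
      exact (((hτ i).2 ω).resolve_right (h i)).2

/-- The value of a process with continuous paths at a measurable time is measurable. -/
lemma measurable_valueAt {Ω : Type*} {m : MeasurableSpace Ω} {T : ℝ} (hT : 0 ≤ T)
    {X : ℝ → Ω → ℝ≥0∞} (hX : ∀ t ∈ Icc (0:ℝ) T, Measurable (X t))
    (hcont : ∀ ω, ContinuousOn (fun t => X t ω) (Icc 0 T)) {σ : Ω → ℝ} (hσ : Measurable σ)
    (hσ_nonneg : ∀ ω, 0 ≤ σ ω) : Measurable (valueAt T X σ) := by
  have hu : Measurable (Function.uncurry fun (t : ℝ) ω => X (projIcc 0 T hT t) ω) :=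
    measurable_uncurry_of_continuous_of_measurable
      (fun ω => (continuousOn_iff_continuous_domRestrict.1 (hcont ω)).comp continuous_projIcc)
      (fun t => hX _ (projIcc 0 T hT t).2)
  have heq : valueAt T X σ =
      fun ω => Function.uncurry (fun (t : ℝ) ω => X (projIcc 0 T hT t) ω) (min (σ ω) T, ω) := by
    funext ω
    have hmem : min (σ ω) T ∈ Icc 0 T := ⟨le_min (hσ_nonneg ω) hT, min_le_right _ _⟩
    simp [valueAt, Function.uncurry, projIcc_of_mem hT hmem]
  rw [heq]
  exact hu.comp ((hσ.min measurable_const).prodMk measurable_id)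

lemma IsStopT.memFtau_le {Ω : Type*} {F : ℝ → MeasurableSpace Ω} {T : ℝ} {σ : Ω → ℝ}
    (hF : ∀ s t : ℝ, s ≤ t → F s ≤ F t) (hσ : IsStopT F T σ) (s : ℝ) :
    MemFtau F σ {ω | σ ω ≤ s} := fun t => by
  have hset : {ω | σ ω ≤ s} ∩ {ω | σ ω ≤ t} = {ω | σ ω ≤ min s t} := by
    ext ω
    simp
  rw [hset]
  exact hF _ _ (min_le_right s t) _ (hσ.1 _)

lemma IsStopT.measurable {Ω : Type*} {F : ℝ → MeasurableSpace Ω} {T : ℝ} {σ : Ω → ℝ}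
    (hF : ∀ s t : ℝ, s ≤ t → F s ≤ F t) (hσ : IsStopT F T σ) : Measurable[F T] σ := by
  let _ : MeasurableSpace Ω := F T
  refine measurable_of_Iic fun t => ?_
  rcases le_or_gt t T with ht | ht
  · exact hF _ _ ht _ (hσ.1 t)
  rcases le_or_gt (T + 1) t with ht' | ht'
  · have hset : σ ⁻¹' Iic t = univ := by
      ext ω
      rcases hσ.2 ω with h | h
      · simpa using h.2.trans ht.le
      · simpa [mem_singleton_iff.1 h] using ht'
    rw [hset]
    exact @MeasurableSet.univ _ (F T)
  · have hset : σ ⁻¹' Iic t = {ω | σ ω ≤ T} := by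
      ext ω
      rcases hσ.2 ω with h | h
      · simp [h.2, h.2.trans ht.le]
      · have h' := mem_singleton_iff.1 h
        exact iff_of_false (fun hle : σ ω ≤ t => by linarith)
          (fun hle : σ ω ≤ T => by linarith)
    rw [hset]
    exact hσ.1 T

lemma IsStopT.not_le_iff {Ω : Type*} {F : ℝ → MeasurableSpace Ω} {T : ℝ} {σ : Ω → ℝ}
    (hσ : IsStopT F T σ) {X : ℝ → Ω → ℝ≥0∞} {ρ : ℝ} {a : ℝ≥0∞} {ω : Ω} (hρ : ρ ≤ T + 1)
    (h : ∀ u ∈ Icc 0 T, ρ ≤ u ↔ X u ω = a) :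
    ¬ ρ ≤ σ ω ↔ σ ω ≤ T ∧ valueAt T X σ ω ≠ a := by
  rcases hσ.2 ω with hω | hω
  · rw [h _ hω, valueAt, min_eq_left hω.2]
    simp [hω.2]
  · simp [mem_singleton_iff.1 hω, hρ]

/-- Convergence of stopping times.  For every nondecreasing sequence of
stopping times `(τ_i)` (with values in `[0,T] ∪ {T+1}`), `Q(lim_i τ_i ≥ S) = 1` iff
`Q̂(lim_i τ_i ≥ R) = 1` (the nondecreasing limit being the supremum). -/
theorem statement5 {Ω : Type*} (F : ℝ → MeasurableSpace Ω) (T : ℝ)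
    (X : ℝ → Ω → ℝ≥0∞) (x₀ : ℝ≥0∞) (Q Qh : @Measure Ω (F T))
    (hsetup : Setup F T X x₀ Q) (hQh : IsProbabilityMeasure Qh)
    (hnum : NumeraireRel F T X x₀ Q Qh)
    (τ : ℕ → Ω → ℝ) (hτ : ∀ i, IsStopT F T (τ i))
    (hτmono : ∀ i ω, τ i ω ≤ τ (i + 1) ω) :
    Q {ω | St T X ω ≤ ⨆ i, τ i ω} = 1 ↔ Qh {ω | Rt T X ω ≤ ⨆ i, τ i ω} = 1 := by
  have hT := hsetup.T_pos.le
  have hQ := hsetup.prob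
  set σ : Ω → ℝ := fun ω => ⨆ i, τ i ω with hσ_def
  have hσ : IsStopT F T σ := IsStopT.iSup hT hτ
  have hσ_meas := hσ.measurable hsetup.mono
  have hσ_nonneg : ∀ ω, 0 ≤ σ ω := fun ω => by
    rcases hσ.2 ω with h | h
    · exact h.1
    · rw [mem_singleton_iff.1 h]
      linarith
  have hV : Measurable[F T] (valueAt T X σ) :=
    measurable_valueAt hT
      (fun t ht => (hsetup.adapted t ht).mono (hsetup.mono t T ht.2) le_rfl)
      hsetup.contPaths hσ_meas hσ_nonneg
  have hA : MeasurableSet[F T] {ω | σ ω ≤ T} := hσ.1 T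
  have hS : {ω | St T X ω ≤ σ ω}ᶜ = {ω | σ ω ≤ T} ∩ (valueAt T X σ ⁻¹' {0})ᶜ := by
    ext ω
    exact hσ.not_le_iff (ciSup_le fun _ => hitBelow_le_horizon _) fun u hu =>
      St_le_iff (hsetup.contPaths ω) (hsetup.absorbing ω) hu
  have hR : {ω | Rt T X ω ≤ σ ω}ᶜ = {ω | σ ω ≤ T} ∩ {ω | valueAt T X σ ω < ⊤} := by
    ext ω
    have h := hσ.not_le_iff (X := X) (ω := ω) (ρ := Rt T X ω) (ciSup_le fun _ => hitAbove_le_horizon _)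
      fun u hu => Rt_le_iff (hsetup.contPaths ω) (hsetup.absorbing ω) hu
    simpa [lt_top_iff_ne_top] using h
  have hS_meas : MeasurableSet[F T] {ω | St T X ω ≤ σ ω}ᶜ := by
    rw [hS]
    exact hA.inter (hV (measurableSet_singleton 0)).compl
  have hR_meas : MeasurableSet[F T] {ω | Rt T X ω ≤ σ ω}ᶜ := by
    rw [hR]
    exact hA.inter (hV measurableSet_Iio)
  rw [← prob_compl_eq_zero_iff hS_meas.of_compl, ← prob_compl_eq_zero_iff hR_meas.of_compl, hR,
    hnum σ hσ _ (hσ.memFtau_le hsetup.mono T), ENNReal.div_eq_zero_iff,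
    or_iff_left hsetup.x₀_lt_top.ne, setLIntegral_eq_zero_iff hA hV, ae_iff, hS]
  refine iff_of_eq (congrArg (Q · = 0) ?_)
  ext ω
  simp

end Paper
end
end

section
/- Let N be a nonnegative progressively measurable process and τ a stopping time with values in [0,T] ∪ {T+1}. Then the process t ↦ N^τ_t · 1_{X^τ_t > 0} is a Q-martingale if and only if the process t ↦ (N^τ_t / X^τ_t) · 1_{0 < X^τ_t < ∞} is a Q̂-martingale. -/
open MeasureTheory Filter Set Topology
open scoped ENNReal NNReal

noncomputable section

namespace Paper

/-- progressive measurability of `N` with respect to the raw filtration `F` on `[0,T]`: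
for every `t ∈ [0,T]`, the map `(s,ω) ↦ N_s(ω)` on `[0,t] × Ω` is
`B([0,t]) ⊗ F_t`-measurable. -/
def ProgMeas {Ω : Type*} (F : ℝ → MeasurableSpace Ω) (T : ℝ)
    (N : ℝ → Ω → ℝ≥0∞) : Prop :=
  ∀ t ∈ Icc (0:ℝ) T,
    @Measurable (Icc (0:ℝ) t × Ω) ℝ≥0∞ (@Prod.instMeasurableSpace _ _ _ (F t)) _
      (fun p => N p.1 p.2)

theorem IsStopT.measurable_min {Ω : Type*} {F : ℝ → MeasurableSpace Ω} {T : ℝ}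
    (hmono : ∀ s t : ℝ, s ≤ t → F s ≤ F t) {τ : Ω → ℝ} (hτ : IsStopT F T τ) {u : ℝ}
    (hu : u ≤ T) : Measurable[F u] (fun ω => min u (min (τ ω) T)) := by
  let _ : MeasurableSpace Ω := F u
  refine measurable_of_Iic fun a => ?_
  rcases le_or_gt u a with h | h
  · convert @MeasurableSet.univ Ω (F u)
    ext ω
    simp [h]
  · have : (fun ω => min u (min (τ ω) T)) ⁻¹' Iic a = {ω | τ ω ≤ a} := by
      ext ω
      simp [h.not_ge, (h.trans_le hu).not_ge]
    rw [this]
    exact hmono a u h.le _ (hτ.1 a)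

theorem ProgMeas.measurable_stopped {Ω : Type*} {F : ℝ → MeasurableSpace Ω} {T : ℝ}
    (hmono : ∀ s t : ℝ, s ≤ t → F s ≤ F t) {N : ℝ → Ω → ℝ≥0∞} (hN : ProgMeas F T N)
    {τ : Ω → ℝ} (hτ : IsStopT F T τ) {u : ℝ} (hu : u ∈ Icc (0:ℝ) T) :
    Measurable[F u] (stopped T N τ u) := by
  have hpos : ∀ ω, 0 ≤ τ ω := fun ω => by
    rcases hτ.2 ω with h | h
    · exact h.1
    · rw [mem_singleton_iff] at h
      linarith [hu.1, hu.2]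
  have hmem : ∀ ω, min u (min (τ ω) T) ∈ Icc (0:ℝ) u := fun ω =>
    ⟨le_min hu.1 (le_min (hpos ω) (hu.1.trans hu.2)), min_le_left _ _⟩
  let _ : MeasurableSpace Ω := F u
  have h : Measurable fun ω => ((⟨min u (min (τ ω) T), hmem ω⟩ : Icc (0:ℝ) u), ω) :=
    ((hτ.measurable_min hmono hu.2).subtype_mk).prodMk measurable_id
  exact (hN u hu).comp h

theorem progMeas_of_continuousOn {Ω : Type*} {F : ℝ → MeasurableSpace Ω} {T : ℝ}
    (hmono : ∀ s t : ℝ, s ≤ t → F s ≤ F t) {X : ℝ → Ω → ℝ≥0∞}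
    (hX : ∀ t ∈ Icc (0:ℝ) T, Measurable[F t] (X t))
    (hcont : ∀ ω, ContinuousOn (fun t => X t ω) (Icc 0 T)) : ProgMeas F T X := by
  intro t ht
  let _ : MeasurableSpace Ω := F t
  refine measurable_uncurry_of_continuous_of_measurable
    (u := fun (s : Icc (0:ℝ) t) ω => X s ω) (fun ω => ?_) fun s => ?_
  · exact ((hcont ω).mono (Icc_subset_Icc_right ht.2)).domRestrict
  · exact (hX s ⟨s.2.1, s.2.2.trans ht.2⟩).mono (hmono _ _ s.2.2) le_rfl

theorem measurableSet_sigmaAt_iff {Ω : Type*} {F : ℝ → MeasurableSpace Ω} {T : ℝ}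
    {τ : Ω → ℝ} (hτ : IsStopT F T τ) {A : Set Ω} :
    MeasurableSet[sigmaAt F τ] A ↔ MemFtau F τ A := by
  refine ⟨fun h => ?_, fun h => MeasurableSpace.measurableSet_generateFrom h⟩
  induction A, h using MeasurableSpace.generateFrom_induction with
  | hC A hA _ => exact hA
  | empty => intro t; simp
  | compl A _ ih =>
    intro t
    have : Aᶜ ∩ {ω | τ ω ≤ t} = {ω | τ ω ≤ t} \ (A ∩ {ω | τ ω ≤ t}) := by
      ext ω
      simp only [mem_inter_iff, mem_compl_iff, Set.mem_sdiff]
      tauto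
    rw [this]
    exact (hτ.1 t).diff (ih t)
  | iUnion A _ ih =>
    intro t
    rw [iUnion_inter]
    exact MeasurableSet.iUnion fun n => ih n t

theorem MemFtau.measurableSet_of_le {Ω : Type*} {F : ℝ → MeasurableSpace Ω} {T : ℝ}
    {τ : Ω → ℝ} {A : Set Ω} (hA : MemFtau F τ A) (hle : ∀ ω, τ ω ≤ T) :
    MeasurableSet[F T] A := by
  simpa [hle] using hA T

theorem ProgMeas.measurable_valueAt {Ω : Type*} {F : ℝ → MeasurableSpace Ω} {T : ℝ}
    (hmono : ∀ s t : ℝ, s ≤ t → F s ≤ F t) (hT : 0 ≤ T) {N : ℝ → Ω → ℝ≥0∞}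
    (hN : ProgMeas F T N) {τ : Ω → ℝ} (hτ : IsStopT F T τ) (hle : ∀ ω, τ ω ≤ T) :
    Measurable[sigmaAt F τ] (valueAt T N τ) := by
  intro C hC
  rw [measurableSet_sigmaAt_iff hτ]
  intro u
  rcases lt_or_ge u 0 with hu | hu
  · convert @MeasurableSet.empty Ω (F u)
    refine eq_empty_of_forall_notMem fun ω hω => ?_
    have h2 : τ ω ≤ u := hω.2
    rcases hτ.2 ω with h | h
    · linarith [h.1]
    · rw [mem_singleton_iff] at h
      linarith
  · have heq : valueAt T N τ ⁻¹' C ∩ {ω | τ ω ≤ u}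
        = stopped T N τ (min u T) ⁻¹' C ∩ {ω | τ ω ≤ u} := by
      ext ω
      refine and_congr_left fun h => ?_
      have h' : τ ω ≤ u := h
      simp [valueAt, stopped, hle ω, h']
    rw [heq]
    have hmem : min u T ∈ Icc (0:ℝ) T := ⟨le_min hu hT, min_le_right _ _⟩
    exact (hmono _ _ (min_le_left u T) _ (hN.measurable_stopped hmono hτ hmem hC)).inter (hτ.1 u)

theorem NumeraireRel.setLIntegral_eq {Ω : Type*} {F : ℝ → MeasurableSpace Ω} {T : ℝ}
    {X : ℝ → Ω → ℝ≥0∞} {x₀ : ℝ≥0∞} {Q Qh : @Measure Ω (F T)}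
    (hnum : NumeraireRel F T X x₀ Q Qh) {σ : Ω → ℝ} (hσ : IsStopT F T σ)
    (hle : ∀ ω, σ ω ≤ T) (hX : Measurable[sigmaAt F σ] (valueAt T X σ))
    {Y : Ω → ℝ≥0∞} (hY : Measurable[sigmaAt F σ] Y) {B : Set Ω} (hB : MemFtau F σ B) :
    ∫⁻ ω in B ∩ {ω | valueAt T X σ ω < ⊤}, Y ω ∂Qh
      = (∫⁻ ω in B, valueAt T X σ ω * Y ω ∂Q) / x₀ := by
  have hm : sigmaAt F σ ≤ F T := fun A hA =>
    ((measurableSet_sigmaAt_iff hσ).1 hA).measurableSet_of_le hle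
  let _ : MeasurableSpace Ω := F T
  have hX' : Measurable (valueAt T X σ) := hX.mono hm le_rfl
  have hY' : Measurable Y := hY.mono hm le_rfl
  have hBm : MeasurableSet B := hB.measurableSet_of_le hle
  have hfin : MeasurableSet {ω | valueAt T X σ ω < ⊤} := hX' measurableSet_Iio
  have key : (Qh.restrict (B ∩ {ω | valueAt T X σ ω < ⊤})).trim hm
      = (x₀⁻¹ • (Q.restrict B).withDensity (valueAt T X σ)).trim hm := by
    refine @Measure.ext Ω (sigmaAt F σ) _ _ fun A hA => ?_
    have hA' : MeasurableSet A := hm _ hA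
    rw [trim_measurableSet_eq hm hA, trim_measurableSet_eq hm hA, Measure.restrict_apply hA',
      ← inter_assoc, Measure.smul_apply, withDensity_apply _ hA', Measure.restrict_restrict hA']
    have hAB : MemFtau F σ (A ∩ B) := (measurableSet_sigmaAt_iff hσ).1
      (hA.inter ((measurableSet_sigmaAt_iff hσ).2 hB))
    rw [hnum σ hσ _ hAB, smul_eq_mul, ENNReal.div_eq_inv_mul]
  rw [← lintegral_trim hm hY, key, lintegral_trim hm hY, lintegral_smul_measure,
    lintegral_withDensity_eq_lintegral_mul _ hX' hY', smul_eq_mul, ENNReal.div_eq_inv_mul]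
  rfl

theorem Setup.ae_lt_top {Ω : Type*} {F : ℝ → MeasurableSpace Ω} {T : ℝ}
    {X : ℝ → Ω → ℝ≥0∞} {x₀ : ℝ≥0∞} {Q : @Measure Ω (F T)} (h : Setup F T X x₀ Q) :
    ∀ᵐ ω ∂Q, ∀ t ∈ Icc (0:ℝ) T, X t ω < ⊤ := by
  let _ : MeasurableSpace Ω := F T
  have := h.prob
  have hTm : T ∈ Icc (0:ℝ) T := ⟨h.T_pos.le, le_rfl⟩
  have hmeas : MeasurableSet {ω | X T ω < ⊤} := h.adapted T hTm measurableSet_Iio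
  have hsub : {ω | Rt T X ω = T + 1} ⊆ {ω | X T ω < ⊤} := by
    intro ω hω
    by_contra hne
    have htop : X T ω = ⊤ := by simpa using hne
    have hR : Rt T X ω ≤ T := ciSup_le fun i => csInf_le
      ⟨0, by
        rintro s (hs | hs)
        · exact hs.1.1
        · rw [mem_singleton_iff] at hs
          linarith [h.T_pos]⟩
      (Or.inl ⟨hTm, by simp [htop]⟩)
    have hω' : Rt T X ω = T + 1 := hω
    linarith
  have hone : Q {ω | X T ω < ⊤} = 1 :=
    le_antisymm prob_le_one (h.noExplosion ▸ measure_mono hsub)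
  have hae : ∀ᵐ ω ∂Q, X T ω < ⊤ := (mem_ae_iff_prob_eq_one hmeas).2 hone
  filter_upwards [hae] with ω hω t ht
  by_contra hne
  have htop : X t ω = ⊤ := by simpa using hne
  rw [h.absorbing ω t ht (Or.inr htop) T ⟨ht.2, le_rfl⟩, htop] at hω
  exact lt_irrefl _ hω

theorem IsStopT.min_const {Ω : Type*} {F : ℝ → MeasurableSpace Ω} {T : ℝ} {τ : Ω → ℝ}
    (hτ : IsStopT F T τ) {t : ℝ} (ht : t ∈ Icc (0:ℝ) T) :
    IsStopT F T (fun ω => min t (τ ω)) := by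
  refine ⟨fun u => ?_, fun ω => Or.inl ⟨le_min ht.1 ?_, (min_le_left _ _).trans ht.2⟩⟩
  · by_cases h : t ≤ u
    · simp [h]
    · simpa [h] using hτ.1 u
  · rcases hτ.2 ω with h | h
    · exact h.1
    · rw [mem_singleton_iff] at h
      linarith [ht.1, ht.2]

theorem IsStopT.memFtau_inter_lt {Ω : Type*} {F : ℝ → MeasurableSpace Ω} {T : ℝ}
    (hmono : ∀ s t : ℝ, s ≤ t → F s ≤ F t) {τ : Ω → ℝ} (hτ : IsStopT F T τ) {s t : ℝ}
    (hst : s ≤ t) {A : Set Ω} (hA : MeasurableSet[F s] A) :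
    MemFtau F (fun ω => min t (τ ω)) (A ∩ {ω | s < τ ω}) := by
  have hs : MeasurableSet[F s] {ω | s < τ ω} := by
    simpa [compl_ofPred] using (hτ.1 s).compl
  intro u
  rcases lt_or_ge u s with hu | hu
  · convert @MeasurableSet.empty Ω (F u)
    refine eq_empty_of_forall_notMem fun ω hω => ?_
    have h1 : s < τ ω := hω.1.2
    have h2 : min t (τ ω) ≤ u := hω.2
    exact absurd h2 (not_le.2 (hu.trans_le (le_min hst h1.le)))
  · refine (hmono _ _ hu _ (hA.inter hs)).inter ?_
    by_cases h : t ≤ u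
    · simp [h]
    · simpa [h] using hτ.1 u

/-- For processes that are constant after `τ`, the martingale identity only needs to be
checked on events contained in `{s < τ}`. -/
theorem isMart_iff_of_const_after {Ω : Type*} {F : ℝ → MeasurableSpace Ω} {T : ℝ}
    (hmono : ∀ s t : ℝ, s ≤ t → F s ≤ F t) {P : @Measure Ω (F T)} {M : ℝ → Ω → ℝ≥0∞}
    {τ : Ω → ℝ} (hτ : IsStopT F T τ)
    (hM : ∀ t ∈ Icc (0:ℝ) T, Measurable[F t] (M t))
    (hconst : ∀ s t ω, s ≤ t → t ≤ T → τ ω ≤ s → M t ω = M s ω) :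
    IsMart F T P M ↔ (∀ t ∈ Icc (0:ℝ) T, ∫⁻ ω, M t ω ∂P ≠ ⊤) ∧
      ∀ s t : ℝ, 0 ≤ s → s ≤ t → t ≤ T → ∀ A : Set Ω, MeasurableSet[F s] A →
        ∫⁻ ω in A ∩ {ω | s < τ ω}, M t ω ∂P = ∫⁻ ω in A ∩ {ω | s < τ ω}, M s ω ∂P := by
  have hlt : ∀ s, MeasurableSet[F s] {ω | s < τ ω} := fun s => by
    simpa [compl_ofPred] using (hτ.1 s).compl
  constructor
  · rintro ⟨-, hfinite, h⟩
    exact ⟨hfinite, fun s t hs hst ht A hA => h s t hs hst ht _ (hA.inter (hlt s))⟩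
  · rintro ⟨hfinite, h⟩
    refine ⟨hM, hfinite, fun s t hs hst ht A hA => ?_⟩
    have hsT := hmono s T (hst.trans ht)
    have hC : MeasurableSet[F T] {ω | s < τ ω} := hsT _ (hlt s)
    have hA' : MeasurableSet[F T] A := hsT _ hA
    let _ : MeasurableSpace Ω := F T
    rw [← lintegral_inter_add_sdiff (M t) A hC, ← lintegral_inter_add_sdiff (M s) A hC,
      h s t hs hst ht A hA]
    congr 1
    exact setLIntegral_congr_fun (hA'.diff hC)
      fun ω hω => hconst s t ω hst ht (not_lt.1 hω.2)

theorem stopped_eq_valueAt_min {Ω : Type*} (T : ℝ) (N : ℝ → Ω → ℝ≥0∞) (τ : Ω → ℝ) (t : ℝ) :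
    stopped T N τ t = valueAt T N (fun ω => min t (τ ω)) := by
  ext ω
  simp [stopped, valueAt, min_assoc]

theorem stopped_eq_of_le {Ω : Type*} {T : ℝ} (N : ℝ → Ω → ℝ≥0∞) {τ : Ω → ℝ} {s t : ℝ} {ω : Ω}
    (hst : s ≤ t) (h : τ ω ≤ s) : stopped T N τ t ω = stopped T N τ s ω := by
  have h1 : min (τ ω) T ≤ s := (min_le_left _ _).trans h
  simp only [stopped, min_eq_right h1, min_eq_right (h1.trans hst)]

theorem measurable_deflated {Ω : Type*} [MeasurableSpace Ω] {f g : Ω → ℝ≥0∞}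
    (hf : Measurable f) (hg : Measurable g) :
    Measurable ({ω | 0 < g ω ∧ g ω < ⊤}.indicator fun ω => f ω / g ω) :=
  (hf.div hg).indicator ((hg measurableSet_Ioi).inter (hg measurableSet_Iio))

theorem NumeraireRel.setLIntegral_deflated {Ω : Type*} {F : ℝ → MeasurableSpace Ω} {T : ℝ}
    {X : ℝ → Ω → ℝ≥0∞} {x₀ : ℝ≥0∞} {Q Qh : @Measure Ω (F T)}
    (hsetup : Setup F T X x₀ Q) (hnum : NumeraireRel F T X x₀ Q Qh)
    {N : ℝ → Ω → ℝ≥0∞} (hN : ProgMeas F T N) {τ : Ω → ℝ} (hτ : IsStopT F T τ)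
    {t : ℝ} (ht : t ∈ Icc (0:ℝ) T) {B : Set Ω} (hB : MemFtau F (fun ω => min t (τ ω)) B) :
    ∫⁻ ω in B, {ω | 0 < stopped T X τ t ω ∧ stopped T X τ t ω < ⊤}.indicator
        (fun ω => stopped T N τ t ω / stopped T X τ t ω) ω ∂Qh
      = (∫⁻ ω in B, {ω | 0 < stopped T X τ t ω}.indicator (stopped T N τ t) ω ∂Q) / x₀ := by
  have hσ := hτ.min_const ht
  have hle : ∀ ω, min t (τ ω) ≤ T := fun ω => (min_le_left _ _).trans ht.2
  have hT := hsetup.T_pos.le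
  have hXm := (progMeas_of_continuousOn hsetup.mono hsetup.adapted
    hsetup.contPaths).measurable_valueAt hsetup.mono hT hσ hle
  have hNm := hN.measurable_valueAt hsetup.mono hT hσ hle
  have key := hnum.setLIntegral_eq hσ hle hXm
    (@measurable_deflated Ω (sigmaAt F _) _ _ hNm hXm) hB
  have hfin : ∀ᵐ ω ∂Q, valueAt T X (fun ω => min t (τ ω)) ω < ⊤ := by
    filter_upwards [hsetup.ae_lt_top] with ω hω
    refine hω _ ⟨le_min ?_ hT, min_le_right _ _⟩
    rcases hσ.2 ω with h | h
    · exact h.1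
    · rw [mem_singleton_iff] at h
      linarith
  have hm : sigmaAt F (fun ω => min t (τ ω)) ≤ F T := fun A hA =>
    ((measurableSet_sigmaAt_iff hσ).1 hA).measurableSet_of_le hle
  have hXm' := hXm.mono hm le_rfl
  have hBm := hB.measurableSet_of_le hle
  rw [stopped_eq_valueAt_min, stopped_eq_valueAt_min]
  set x := valueAt T X (fun ω => min t (τ ω))
  set n := valueAt T N (fun ω => min t (τ ω))
  let _ : MeasurableSpace Ω := F T
  have hD : MeasurableSet {ω | x ω < ⊤} := hXm' measurableSet_Iio
  rw [← lintegral_inter_add_sdiff _ B hD, key]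
  have hzero : ∫⁻ ω in B \ {ω | x ω < ⊤},
      {ω | 0 < x ω ∧ x ω < ⊤}.indicator (fun ω => n ω / x ω) ω ∂Qh = 0 := by
    rw [setLIntegral_congr_fun (hBm.diff hD) (g := fun _ => 0), lintegral_zero]
    intro ω hω
    exact indicator_of_notMem (fun h => hω.2 h.2) _
  rw [hzero, add_zero]
  congr 1
  refine lintegral_congr_ae (ae_restrict_of_ae ?_)
  filter_upwards [hfin] with ω hω
  by_cases h0 : 0 < x ω
  · rw [indicator_of_mem (show ω ∈ {ω | 0 < x ω ∧ x ω < ⊤} from ⟨h0, hω⟩),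
      indicator_of_mem (show ω ∈ {ω | 0 < x ω} from h0), ENNReal.mul_div_cancel h0.ne' hω.ne]
  · rw [indicator_of_notMem (fun h => h0 h.1),
      indicator_of_notMem (show ω ∉ {ω | 0 < x ω} from h0), mul_zero]

/-- Equivalence of martingales, part (i).  For a nonnegative
progressively measurable `N` and a stopping time `τ`:
`N^τ·1_{X^τ > 0}` is a `Q`-martingale iff `(N^τ/X^τ)·1_{0 < X^τ < ∞}` is a
`Q̂`-martingale. -/
theorem statement6 {Ω : Type*} (F : ℝ → MeasurableSpace Ω) (T : ℝ)
    (X : ℝ → Ω → ℝ≥0∞) (x₀ : ℝ≥0∞) (Q Qh : @Measure Ω (F T))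
    (hsetup : Setup F T X x₀ Q) (hQh : IsProbabilityMeasure Qh)
    (hnum : NumeraireRel F T X x₀ Q Qh)
    (N : ℝ → Ω → ℝ≥0∞) (hN : ProgMeas F T N)
    (τ : Ω → ℝ) (hτ : IsStopT F T τ) :
    IsMart F T Q
      (fun t => {ω | 0 < stopped T X τ t ω}.indicator (stopped T N τ t)) ↔
    IsMart F T Qh
      (fun t => {ω | 0 < stopped T X τ t ω ∧ stopped T X τ t ω < ⊤}.indicator
        (fun ω => stopped T N τ t ω / stopped T X τ t ω)) := by
  have hmono := hsetup.mono
  have hX := progMeas_of_continuousOn hmono hsetup.adapted hsetup.contPaths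
  have hXm := fun t ht => hX.measurable_stopped hmono hτ (u := t) ht
  have hNm := fun t ht => hN.measurable_stopped hmono hτ (u := t) ht
  have hx₀ : x₀⁻¹ ≠ 0 := ENNReal.inv_ne_zero.2 hsetup.x₀_lt_top.ne
  have hx₀' : x₀⁻¹ ≠ ⊤ := ENNReal.inv_ne_top.2 hsetup.x₀_pos.ne'
  rw [isMart_iff_of_const_after hmono hτ, isMart_iff_of_const_after hmono hτ]
  · refine and_congr (forall₂_congr fun t ht => ?_) ?_
    · have h := hnum.setLIntegral_deflated hsetup hN hτ ht (B := univ)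
        fun u => by simpa using (hτ.min_const ht).1 u
      simp only [Measure.restrict_univ] at h
      rw [h, ENNReal.div_eq_inv_mul, not_iff_not, ENNReal.mul_eq_top]
      simp [hx₀, hx₀']
    · refine forall_congr' fun s => forall_congr' fun t => forall_congr' fun hs =>
        forall_congr' fun hst => forall_congr' fun ht => forall₂_congr fun A hA => ?_
      rw [hnum.setLIntegral_deflated hsetup hN hτ ⟨hs.trans hst, ht⟩
          (hτ.memFtau_inter_lt hmono hst hA),
        hnum.setLIntegral_deflated hsetup hN hτ ⟨hs, hst.trans ht⟩
          (hτ.memFtau_inter_lt hmono le_rfl hA),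
        ENNReal.div_eq_inv_mul, ENNReal.div_eq_inv_mul, ENNReal.mul_right_inj hx₀ hx₀']
  · exact fun t ht => @measurable_deflated Ω (F t) _ _ (hNm t ht) (hXm t ht)
  · intro s t ω hst _ h
    simp only [indicator, mem_ofPred_eq, stopped_eq_of_le _ hst h]
  · exact fun t ht => (hNm t ht).indicator (hXm t ht measurableSet_Ioi)
  · intro s t ω hst _ h
    simp only [indicator, mem_ofPred_eq, stopped_eq_of_le _ hst h]
    congr

end Paper
end
end
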